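/- arXiv:1202.0025 — 3 statements merged into one kernel-verified Lean document; each statement's English description precedes it below -/
import Mathlib

section
/- Let a, b be positive real numbers. Set P = ∫_{x ∈ (0,1)} x^(a+b-1) / √(1 - x^(2b)) dx and Q = ∫_{x ∈ (0,1)} x^(a-1) / √(1 - x^(2b)) dx. Then a · P / Q = 2b · (Γ(a/(2b) + 1/2) / Γ(a/(2b)))^2, where Γ denotes the real Gamma function. -/
/-- Euler's integral for the real Beta function. -/
theorem integral_Ioo_rpow_mul_one_sub_rpow {u v : ℝ} (hu : 0 < u) (hv : 0 < v) :
    ∫ t in Set.Ioo (0:ℝ) 1, t ^ (u - 1) * (1 - t) ^ (v - 1) = ProbabilityTheory.beta u v := by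
  rw [ProbabilityTheory.beta_eq_betaIntegralReal u v hu hv, Complex.betaIntegral,
    intervalIntegral.integral_of_le (by norm_num), ← MeasureTheory.integral_Ioc_eq_integral_Ioo,
    ← RCLike.re_to_complex, ← integral_re]
  · refine MeasureTheory.setIntegral_congr_fun measurableSet_Ioc fun x ⟨hx₁, hx₂⟩ ↦ ?_
    norm_cast
    rw [← Complex.ofReal_cpow, ← Complex.ofReal_cpow, RCLike.re_to_complex,
      Complex.re_mul_ofReal, Complex.ofReal_re]
    all_goals linarith
  · convert! Complex.betaIntegral_convergent (u := u) (v := v) (by simpa) (by simpa)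
    rw [intervalIntegrable_iff_integrableOn_Ioc_of_le (by simp), MeasureTheory.IntegrableOn]

theorem image_rpow_Ioo_zero_one {p : ℝ} (hp : 0 < p) :
    (fun x : ℝ ↦ x ^ p) '' Set.Ioo 0 1 = Set.Ioo 0 1 := by
  ext y
  constructor
  · rintro ⟨x, hx, rfl⟩
    exact ⟨Real.rpow_pos_of_pos hx.1 p, Real.rpow_lt_one hx.1.le hx.2 hp⟩
  · intro hy
    exact ⟨y ^ p⁻¹, ⟨Real.rpow_pos_of_pos hy.1 _, Real.rpow_lt_one hy.1.le hy.2 (inv_pos.2 hp)⟩,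
      Real.rpow_inv_rpow hy.1.le hp.ne'⟩

/-- Substitution `y = x ^ p` in integrals over `(0, 1)`. -/
theorem integral_comp_rpow_Ioo_zero_one (g : ℝ → ℝ) {p : ℝ} (hp : 0 < p) :
    ∫ x in Set.Ioo (0:ℝ) 1, p * x ^ (p - 1) * g (x ^ p) = ∫ y in Set.Ioo (0:ℝ) 1, g y := by
  have h := MeasureTheory.integral_image_eq_integral_abs_deriv_smul
    (measurableSet_Ioo (a := (0:ℝ)) (b := 1))
    (fun x hx ↦ (Real.hasDerivAt_rpow_const (p := p)
      (Or.inl (Set.mem_Ioo.mp hx).1.ne')).hasDerivWithinAt)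
    ((Real.rpow_left_injOn hp.ne').mono fun x hx ↦ (Set.mem_Ioo.mp hx).1.le) g
  rw [image_rpow_Ioo_zero_one hp] at h
  rw [h]
  refine MeasureTheory.setIntegral_congr_fun measurableSet_Ioo fun x hx ↦ ?_
  have := Real.rpow_nonneg hx.1.le (p - 1)
  rw [abs_of_nonneg (by positivity), smul_eq_mul]

theorem integral_rpow_div_sqrt_one_sub_rpow {s p : ℝ} (hs : 0 < s) (hp : 0 < p) :
    ∫ x in Set.Ioo (0:ℝ) 1, x ^ (s - 1) / Real.sqrt (1 - x ^ p) =
      p⁻¹ * ProbabilityTheory.beta (s / p) (1 / 2) := by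
  rw [← integral_Ioo_rpow_mul_one_sub_rpow (div_pos hs hp) one_half_pos,
    ← integral_comp_rpow_Ioo_zero_one (fun t ↦ t ^ (s / p - 1) * (1 - t) ^ (1 / 2 - 1 : ℝ)) hp,
    ← MeasureTheory.integral_const_mul]
  refine MeasureTheory.setIntegral_congr_fun measurableSet_Ioo fun x hx ↦ ?_
  have hx' : 0 ≤ 1 - x ^ p := sub_nonneg.2 (Real.rpow_le_one hx.1.le hx.2.le hp.le)
  have hsqrt : (1 - x ^ p) ^ (1 / 2 - 1 : ℝ) = (Real.sqrt (1 - x ^ p))⁻¹ := by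
    rw [Real.sqrt_eq_rpow, ← Real.rpow_neg hx']
    norm_num
  have hpow : x ^ (p - 1) * (x ^ p) ^ (s / p - 1) = x ^ (s - 1) := by
    rw [← Real.rpow_mul hx.1.le, ← Real.rpow_add hx.1]
    congr 1
    field_simp
    ring
  simp only [hsqrt, ← hpow]
  field_simp

theorem euler_k_squared_gamma
    (a b : ℝ) (ha : 0 < a) (hb : 0 < b)
    (P Q : ℝ)
    (hP : P = ∫ x in Set.Ioo (0:ℝ) 1, x ^ (a + b - 1) / Real.sqrt (1 - x ^ (2 * b)))
    (hQ : Q = ∫ x in Set.Ioo (0:ℝ) 1, x ^ (a - 1) / Real.sqrt (1 - x ^ (2 * b))) :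
    a * P / Q = 2 * b * (Real.Gamma (a / (2 * b) + 1 / 2) / Real.Gamma (a / (2 * b))) ^ 2 := by
  have h2b : 0 < 2 * b := by positivity
  rw [integral_rpow_div_sqrt_one_sub_rpow (add_pos ha hb) h2b] at hP
  rw [integral_rpow_div_sqrt_one_sub_rpow ha h2b] at hQ
  have hc : 0 < a / (2 * b) := div_pos ha h2b
  have hshift : (a + b) / (2 * b) = a / (2 * b) + 1 / 2 := by field_simp
  have hac : a = 2 * b * (a / (2 * b)) := by field_simp
  rw [hP, hQ, hshift]
  generalize a / (2 * b) = c at hc hac ⊢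
  have h₀ := (Real.Gamma_pos_of_pos hc).ne'
  have h₁ := (Real.Gamma_pos_of_pos (add_pos hc one_half_pos)).ne'
  have h₂ := (Real.Gamma_pos_of_pos (one_half_pos (α := ℝ))).ne'
  rw [ProbabilityTheory.beta, ProbabilityTheory.beta, add_assoc, add_halves,
    Real.Gamma_add_one hc.ne', hac]
  field_simp
end

section
/- Let a, b be positive real numbers. Set Q₁ = ∫_{x ∈ (0,1)} x^(a-1) / √(1 - x^(2b)) dx, P₁ = ∫_{x ∈ (0,1)} x^(a+b-1) / √(1 - x^(2b)) dx, and P₂ = ∫_{x ∈ (0,1)} x^(a+2b-1) / √(1 - x^(2b)) dx. Then √(a · P₁ / Q₁) · √((a+b) · P₂ / P₁) = a. (Euler's identity Δ(1/2) · Θ(1/2) = a for the interpolated values of the products a(a+2b)(a+4b)··· and (a+b)(a+3b)(a+5b)···.) -/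
lemma one_sub_rpow_pos {x c : ℝ} (hx : x ∈ Set.Ioo (0:ℝ) 1) (hc : 0 < c) : 0 < 1 - x ^ c :=
  sub_pos.2 (Real.rpow_lt_one hx.1.le hx.2 hc)

lemma hasDerivAt_sqrt_one_sub_rpow {b x : ℝ} (hb : 0 < b) (hx : x ∈ Set.Ioo (0:ℝ) 1) :
    HasDerivAt (fun x : ℝ => Real.sqrt (1 - x ^ (2 * b)))
      (-b * (x ^ (2 * b - 1) / Real.sqrt (1 - x ^ (2 * b)))) x := by
  have hpos := one_sub_rpow_pos hx (c := 2 * b) (by positivity)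
  have h := ((Real.hasDerivAt_rpow_const (p := 2 * b) (Or.inl hx.1.ne')).const_sub 1).sqrt hpos.ne'
  convert h using 1
  have := Real.sqrt_pos.2 hpos
  field_simp

lemma continuous_sqrt_one_sub_rpow {b : ℝ} (hb : 0 < b) :
    Continuous fun x : ℝ => Real.sqrt (1 - x ^ (2 * b)) :=
  Real.continuous_sqrt.comp
    (continuous_const.sub (Real.continuous_rpow_const (by positivity)))

lemma integrableOn_rpow_div_sqrt_one_sub_rpow {b c : ℝ} (hb : 0 < b) (hc : 0 < c) :
    MeasureTheory.IntegrableOn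
      (fun x : ℝ => x ^ (c - 1) / Real.sqrt (1 - x ^ (2 * b))) (Set.Ioo 0 1) := by
  have h₁ : MeasureTheory.IntegrableOn (fun x : ℝ => x ^ (c - 1)) (Set.Ioo 0 1) :=
    (intervalIntegral.integrableOn_Ioo_rpow_iff one_pos).2 (by linarith)
  have h₂ : MeasureTheory.IntegrableOn
      (fun x : ℝ => x ^ (2 * b - 1) / Real.sqrt (1 - x ^ (2 * b))) (Set.Ioo 0 1) := by
    refine (intervalIntegral.integrableOn_deriv_of_nonneg
      (g := fun x : ℝ => -b⁻¹ * Real.sqrt (1 - x ^ (2 * b))) ?_ ?_ ?_).mono_set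
      Set.Ioo_subset_Ioc_self
    · exact (continuous_const.mul (continuous_sqrt_one_sub_rpow hb)).continuousOn
    · intro x hx
      exact ((hasDerivAt_sqrt_one_sub_rpow hb hx).const_mul (-b⁻¹)).congr_deriv
        (by field_simp)
    · intro x hx
      have := hx.1
      positivity
  refine (h₁.add h₂).mono' (Measurable.aestronglyMeasurable (by fun_prop)) ?_
  filter_upwards [MeasureTheory.ae_restrict_mem measurableSet_Ioo] with x hx
  have hx0 := hx.1
  have hpos := one_sub_rpow_pos hx (c := 2 * b) (by positivity)
  have hs := Real.sqrt_pos.2 hpos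
  have hsq := Real.sq_sqrt hpos.le
  rw [Real.norm_of_nonneg (by positivity), Pi.add_apply]
  have hs1 : Real.sqrt (1 - x ^ (2 * b)) ≤ 1 := by
    refine Real.sqrt_le_iff.2 ⟨zero_le_one, ?_⟩
    linarith [Real.rpow_pos_of_pos hx0 (2 * b)]
  have hxc : x ^ (c - 1) * x ^ (2 * b) = x ^ c * x ^ (2 * b - 1) := by
    rw [← Real.rpow_add hx0, ← Real.rpow_add hx0]
    ring_nf
  have hxc1 : x ^ c ≤ 1 := (Real.rpow_lt_one hx0.le hx.2 hc).le
  have hA := Real.rpow_pos_of_pos hx0 (c - 1)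
  have hB := Real.rpow_pos_of_pos hx0 (2 * b - 1)
  calc x ^ (c - 1) / Real.sqrt (1 - x ^ (2 * b))
      = x ^ (c - 1) * Real.sqrt (1 - x ^ (2 * b))
        + x ^ c * x ^ (2 * b - 1) / Real.sqrt (1 - x ^ (2 * b)) := by
        rw [← hxc]
        field_simp
        rw [hsq]
        ring
    _ ≤ _ := by
        gcongr
        · exact mul_le_of_le_one_right hA.le hs1
        · exact mul_le_of_le_one_left hB.le hxc1

lemma integral_rpow_div_sqrt_one_sub_rpow_pos {b c : ℝ} (hb : 0 < b) (hc : 0 < c) :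
    0 < ∫ x in Set.Ioo (0:ℝ) 1, x ^ (c - 1) / Real.sqrt (1 - x ^ (2 * b)) := by
  have h := integrableOn_rpow_div_sqrt_one_sub_rpow hb hc
  rw [← MeasureTheory.integral_Ioc_eq_integral_Ioo,
    ← intervalIntegral.integral_of_le zero_le_one]
  refine intervalIntegral.intervalIntegral_pos_of_pos_on
    ((intervalIntegrable_iff_integrableOn_Ioo_of_le zero_le_one).2 h) (fun x hx => ?_) one_pos
  exact div_pos (Real.rpow_pos_of_pos hx.1 _)
    (Real.sqrt_pos.2 (one_sub_rpow_pos hx (by positivity)))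

lemma integral_rpow_div_sqrt_one_sub_rpow_recurrence {a b : ℝ} (ha : 0 < a) (hb : 0 < b) :
    (a + b) * ∫ x in Set.Ioo (0:ℝ) 1, x ^ (a + 2 * b - 1) / Real.sqrt (1 - x ^ (2 * b)) =
      a * ∫ x in Set.Ioo (0:ℝ) 1, x ^ (a - 1) / Real.sqrt (1 - x ^ (2 * b)) := by
  have h₁ := (integrableOn_rpow_div_sqrt_one_sub_rpow hb ha).const_mul a
  have h₂ := (integrableOn_rpow_div_sqrt_one_sub_rpow hb
    (show 0 < a + 2 * b by positivity)).const_mul (a + b)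
  have key := intervalIntegral.integral_eq_sub_of_hasDerivAt_of_le zero_le_one
    (f := fun x : ℝ => x ^ a * Real.sqrt (1 - x ^ (2 * b)))
    (f' := fun x : ℝ => a * (x ^ (a - 1) / Real.sqrt (1 - x ^ (2 * b))) -
      (a + b) * (x ^ (a + 2 * b - 1) / Real.sqrt (1 - x ^ (2 * b))))
    ((Real.continuous_rpow_const ha.le).mul (continuous_sqrt_one_sub_rpow hb)).continuousOn
    (fun x hx => by
      have hpos := one_sub_rpow_pos hx (c := 2 * b) (by positivity)
      have hs := Real.sqrt_pos.2 hpos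
      have hsq := Real.sq_sqrt hpos.le
      refine ((Real.hasDerivAt_rpow_const (p := a) (Or.inl hx.1.ne')).mul
        (hasDerivAt_sqrt_one_sub_rpow hb hx)).congr_deriv ?_
      have e₁ : x ^ (a + 2 * b - 1) = x ^ (a - 1) * x ^ (2 * b) := by
        rw [← Real.rpow_add hx.1]
        ring_nf
      have e₂ : x ^ a * x ^ (2 * b - 1) = x ^ (a - 1) * x ^ (2 * b) := by
        rw [← Real.rpow_add hx.1, ← Real.rpow_add hx.1]
        ring_nf
      rw [e₁]
      field_simp
      rw [hsq]
      linear_combination -b * e₂)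
    ((intervalIntegrable_iff_integrableOn_Ioo_of_le zero_le_one).2 (h₁.sub h₂))
  rw [intervalIntegral.integral_of_le zero_le_one, MeasureTheory.integral_Ioc_eq_integral_Ioo,
    MeasureTheory.integral_sub h₁ h₂, MeasureTheory.integral_const_mul,
    MeasureTheory.integral_const_mul] at key
  simp only [Real.one_rpow, sub_self, Real.sqrt_zero, mul_zero, Real.zero_rpow ha.ne',
    zero_mul] at key
  linarith

theorem euler_half_interpolation_product
    (a b : ℝ) (ha : 0 < a) (hb : 0 < b)
    (Q₁ P₁ P₂ : ℝ)
    (hQ₁ : Q₁ = ∫ x in Set.Ioo (0:ℝ) 1, x ^ (a - 1) / Real.sqrt (1 - x ^ (2 * b)))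
    (hP₁ : P₁ = ∫ x in Set.Ioo (0:ℝ) 1, x ^ (a + b - 1) / Real.sqrt (1 - x ^ (2 * b)))
    (hP₂ : P₂ = ∫ x in Set.Ioo (0:ℝ) 1, x ^ (a + 2 * b - 1) / Real.sqrt (1 - x ^ (2 * b))) :
    Real.sqrt (a * P₁ / Q₁) * Real.sqrt ((a + b) * P₂ / P₁) = a := by
  have hQ : 0 < Q₁ := hQ₁ ▸ integral_rpow_div_sqrt_one_sub_rpow_pos hb ha
  have hP : 0 < P₁ := hP₁ ▸ integral_rpow_div_sqrt_one_sub_rpow_pos hb (add_pos ha hb)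
  have hrec : (a + b) * P₂ = a * Q₁ := by
    rw [hP₂, hQ₁]
    exact integral_rpow_div_sqrt_one_sub_rpow_recurrence ha hb
  rw [hrec, ← Real.sqrt_mul (by positivity),
    show a * P₁ / Q₁ * (a * Q₁ / P₁) = a ^ 2 by field_simp, Real.sqrt_sq ha.le]
end

section
/- Let a, b be positive real numbers. Set P = ∫_{x ∈ (0,1)} x^(a + b/2 - 1) / √(1 - x^b) dx and Q = ∫_{x ∈ (0,1)} x^(a-1) / √(1 - x^b) dx. Then √b · Γ(a/b + 1/2) / Γ(a/b) = √(a · P / Q), where Γ denotes the real Gamma function. (This is the value Γ:1/2 interpolating the products a, a(a+b), a(a+b)(a+2b), ... at index 1/2.) -/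
open MeasureTheory Set in
/-- The real beta integral expressed through the beta function. -/
theorem setIntegral_rpow_mul_one_sub_rpow {u v : ℝ} (hu : 0 < u) (hv : 0 < v) :
    ∫ x in Ioo (0:ℝ) 1, x ^ (u - 1) * (1 - x) ^ (v - 1) = ProbabilityTheory.beta u v := by
  rw [ProbabilityTheory.beta_eq_betaIntegralReal u v hu hv, Complex.betaIntegral,
    intervalIntegral.integral_of_le zero_le_one, ← integral_Ioc_eq_integral_Ioo,
    ← RCLike.re_to_complex, ← integral_re]
  · refine setIntegral_congr_fun measurableSet_Ioc fun x ⟨hx₀, hx₁⟩ ↦ ?_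
    norm_cast
    rw [← Complex.ofReal_cpow hx₀.le, ← Complex.ofReal_cpow (by linarith), RCLike.re_to_complex,
      Complex.re_mul_ofReal, Complex.ofReal_re]
  · rw [← IntegrableOn, ← intervalIntegrable_iff_integrableOn_Ioc_of_le zero_le_one]
    exact Complex.betaIntegral_convergent (u := u) (v := v) (by simpa) (by simpa)

open MeasureTheory Set in
/-- Substitution `y = x ^ p` in integrals over the unit interval. -/
theorem setIntegral_comp_rpow_Ioo_zero_one (g : ℝ → ℝ) {p : ℝ} (hp : 0 < p) :
    ∫ x in Ioo (0:ℝ) 1, p * x ^ (p - 1) * g (x ^ p) = ∫ y in Ioo (0:ℝ) 1, g y := by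
  have himage : (· ^ p) '' Ioo (0:ℝ) 1 = Ioo (0:ℝ) 1 := by
    ext x
    constructor
    · rintro ⟨y, hy, rfl⟩
      exact ⟨Real.rpow_pos_of_pos hy.1 p, Real.rpow_lt_one hy.1.le hy.2 hp⟩
    · exact fun hx ↦ ⟨x ^ p⁻¹, ⟨Real.rpow_pos_of_pos hx.1 _,
        Real.rpow_lt_one hx.1.le hx.2 (inv_pos.2 hp)⟩, Real.rpow_inv_rpow hx.1.le hp.ne'⟩
  have hsubst := integral_image_eq_integral_abs_deriv_smul measurableSet_Ioo
    (fun x (hx : x ∈ Ioo (0:ℝ) 1) ↦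
      (Real.hasDerivAt_rpow_const (p := p) (Or.inl hx.1.ne')).hasDerivWithinAt)
    ((Real.rpow_left_injOn hp.ne').mono fun x hx ↦ hx.1.le) g
  rw [himage] at hsubst
  rw [hsubst]
  refine setIntegral_congr_fun measurableSet_Ioo fun x hx ↦ ?_
  have hx₀ : 0 < x := hx.1
  simp only [smul_eq_mul]
  rw [abs_of_pos (by positivity)]

open MeasureTheory Set in
/-- Euler's integral `∫ x ^ (c - 1) / √(1 - x ^ b)` over the unit interval. -/
theorem setIntegral_rpow_div_sqrt_one_sub_rpow {b c : ℝ} (hb : 0 < b) (hc : 0 < c) :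
    ∫ x in Ioo (0:ℝ) 1, x ^ (c - 1) / √(1 - x ^ b) =
      ProbabilityTheory.beta (c / b) (1 / 2) / b := by
  rw [eq_div_iff hb.ne', mul_comm,
    ← setIntegral_rpow_mul_one_sub_rpow (div_pos hc hb) one_half_pos,
    ← setIntegral_comp_rpow_Ioo_zero_one (fun y ↦ y ^ (c / b - 1) * (1 - y) ^ (1 / 2 - 1 : ℝ)) hb,
    ← integral_const_mul]
  refine setIntegral_congr_fun measurableSet_Ioo fun x hx ↦ ?_
  have hxb : x ^ b < 1 := Real.rpow_lt_one hx.1.le hx.2 hb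
  have hpow : x ^ (c - 1) = x ^ (b - 1) * (x ^ b) ^ (c / b - 1) := by
    rw [← Real.rpow_mul hx.1.le, ← Real.rpow_add hx.1]
    congr 1
    field_simp
    ring
  have hsqrt : (1 - x ^ b) ^ (1 / 2 - 1 : ℝ) = (√(1 - x ^ b))⁻¹ := by
    rw [Real.sqrt_eq_rpow, ← Real.rpow_neg (by linarith)]
    norm_num
  rw [hpow, hsqrt]
  ring

theorem euler_gamma_half_interpolation
    (a b : ℝ) (ha : 0 < a) (hb : 0 < b)
    (P Q : ℝ)
    (hP : P = ∫ x in Set.Ioo (0:ℝ) 1, x ^ (a + b / 2 - 1) / Real.sqrt (1 - x ^ b))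
    (hQ : Q = ∫ x in Set.Ioo (0:ℝ) 1, x ^ (a - 1) / Real.sqrt (1 - x ^ b)) :
    Real.sqrt b * Real.Gamma (a / b + 1 / 2) / Real.Gamma (a / b) =
      Real.sqrt (a * P / Q) := by
  rw [setIntegral_rpow_div_sqrt_one_sub_rpow hb (by positivity)] at hP hQ
  have hs : 0 < a / b := div_pos ha hb
  have hΓ := Real.Gamma_pos_of_pos hs
  have hΓ_half := Real.Gamma_pos_of_pos (add_pos hs one_half_pos)
  have hΓ_one_half := Real.Gamma_pos_of_pos one_half_pos
  have hratio : a * P / Q = b * (Real.Gamma (a / b + 1 / 2) / Real.Gamma (a / b)) ^ 2 := by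
    have hP_arg : (a + b / 2) / b = a / b + 1 / 2 := by field_simp
    have hsum : a / b + 1 / 2 + 1 / 2 = a / b + 1 := by ring
    rw [hP, hQ, hP_arg, ProbabilityTheory.beta, ProbabilityTheory.beta, hsum,
      Real.Gamma_add_one hs.ne']
    generalize Real.Gamma (a / b + 1 / 2) = y at *
    generalize Real.Gamma (a / b) = z at *
    generalize Real.Gamma (1 / 2) = w at *
    field_simp
  rw [hratio, Real.sqrt_mul hb.le, Real.sqrt_sq (by positivity), mul_div_assoc]
end
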